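/- For every integer s and all positive integers k and m, the sum of (a-s, m^k)_k over all integers a with 1 ≤ a ≤ m^k and (a, m^k)_k = 1 equals d_s^(k)(m)·φ^(k)(m). -/

import Mathlib

/-- The k-th power greatest common divisor `(a,b)_k`: the largest k-th power `d^k`
(with `d` a positive integer) dividing both `a` and `b`. -/
noncomputable def kgcd (k : ℕ) (a b : ℤ) : ℕ :=
  sSup {n : ℕ | (∃ d : ℕ, 0 < d ∧ n = d ^ k) ∧ (n : ℤ) ∣ a ∧ (n : ℤ) ∣ b}

/-- The Eckford Cohen totient function `φ^(k)(m)`: the number of integers `a` with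
`1 ≤ a ≤ m^k` and `(a, m^k)_k = 1`. -/
noncomputable def cohenTotient (k m : ℕ) : ℕ :=
  ((Finset.Icc 1 (m ^ k)).filter fun a : ℕ => kgcd k (a : ℤ) ((m : ℤ) ^ k) = 1).card

/-- The multiplicative function `d_s^(k)`: on a prime power `p^v` it equals `1` if
`p^k ∣ s` and `v + 1` otherwise; for general `m` it is the product over the prime powers
`p^v` exactly dividing `m`. -/
def dsk (s : ℤ) (k m : ℕ) : ℕ :=
  ∏ p ∈ m.primeFactors, if (p : ℤ) ^ k ∣ s then 1 else m.factorization p + 1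

lemma kgcd_eq (k m g : ℕ) (hm : 0 < m) (a : ℤ) (hk : 0 < k)
    (h : ∀ d : ℕ, d ∣ g ↔ d ∣ m ∧ (d : ℤ) ^ k ∣ a) : kgcd k a ((m : ℤ) ^ k) = g ^ k := by
  have hg : g ∣ m := ((h g).1 dvd_rfl).1
  have hg0 : 0 < g := Nat.pos_of_dvd_of_pos hg hm
  unfold kgcd
  apply IsGreatest.csSup_eq
  constructor
  · refine ⟨⟨g, hg0, rfl⟩, ?_, ?_⟩
    · have := ((h g).1 dvd_rfl).2
      exact_mod_cast this
    · exact_mod_cast pow_dvd_pow_of_dvd hg k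
  · rintro n ⟨⟨d, hd, rfl⟩, h1, h2⟩
    have h2' : d ^ k ∣ m ^ k := by exact_mod_cast h2
    have h3 : d ∣ m := (Nat.pow_dvd_pow_iff hk.ne').1 h2'
    have : d ∣ g := (h d).2 ⟨h3, by exact_mod_cast h1⟩
    exact Nat.pow_le_pow_left (Nat.le_of_dvd hg0 this) k

lemma kgcd_spec (k m : ℕ) (hm : 0 < m) (a : ℤ) (hk : 0 < k) :
    ∃ g : ℕ, (∀ d : ℕ, d ∣ g ↔ d ∣ m ∧ (d : ℤ) ^ k ∣ a) ∧
      kgcd k a ((m : ℤ) ^ k) = g ^ k := by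
  suffices H : ∃ g : ℕ, (∀ d : ℕ, d ∣ g ↔ d ∣ m ∧ (d : ℤ) ^ k ∣ a) by
    obtain ⟨g, hg⟩ := H
    exact ⟨g, hg, kgcd_eq k m g hm a hk hg⟩
  classical
  have key : ∀ S : Finset ℕ, (∀ d ∈ S, (d : ℤ) ^ k ∣ a) → ((S.lcm id : ℕ) : ℤ) ^ k ∣ a := by
    intro S
    induction S using Finset.induction_on with
    | empty => intro _; simp
    | insert x S hx ih =>
      intro h
      have h1 := ih fun d hd => h d (Finset.mem_insert_of_mem hd)
      have h2 := h x (Finset.mem_insert_self _ _)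
      rw [Finset.lcm_insert]
      have h1' : (S.lcm id) ^ k ∣ a.natAbs := by
        rw [← Int.natCast_dvd]; exact_mod_cast h1
      have h2' : x ^ k ∣ a.natAbs := by
        rw [← Int.natCast_dvd]; exact_mod_cast h2
      have h3 : (Nat.lcm x (S.lcm id)) ^ k ∣ a.natAbs := by
        rw [← Nat.pow_lcm_pow]
        exact Nat.lcm_dvd h2' h1'
      have h4 := Int.natCast_dvd.2 h3
      exact_mod_cast h4
  refine ⟨(m.divisors.filter fun d : ℕ => (d : ℤ) ^ k ∣ a).lcm id, fun d => ⟨fun hd => ?_, ?_⟩⟩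
  · constructor
    · refine hd.trans (Finset.lcm_dvd fun x hx => ?_)
      simp only [Finset.mem_filter, Nat.mem_divisors] at hx
      exact hx.1.1
    · refine dvd_trans (pow_dvd_pow_of_dvd (Int.natCast_dvd_natCast.2 hd) k) (key _ fun x hx => ?_)
      exact (Finset.mem_filter.1 hx).2
  · rintro ⟨h1, h2⟩
    exact Finset.dvd_lcm (f := id) (Finset.mem_filter.2 ⟨Nat.mem_divisors.2 ⟨h1, hm.ne'⟩, h2⟩)

lemma kgcd_mul (k m n : ℕ) (hm : 0 < m) (hn : 0 < n) (hk : 0 < k) (h : m.Coprime n) (a : ℤ) :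
    kgcd k a (((m * n : ℕ) : ℤ) ^ k) = kgcd k a ((m : ℤ) ^ k) * kgcd k a ((n : ℤ) ^ k) := by
  obtain ⟨g, hg, eg⟩ := kgcd_spec k m hm a hk
  obtain ⟨l, hl, el⟩ := kgcd_spec k n hn a hk
  rw [eg, el, ← mul_pow]
  apply kgcd_eq k (m * n) (g * l) (Nat.mul_pos hm hn) a hk
  intro d
  have g1 := (hg g).1 dvd_rfl
  have l1 := (hl l).1 dvd_rfl
  constructor
  · intro hd
    refine ⟨hd.trans (mul_dvd_mul g1.1 l1.1), ?_⟩
    have hc : g.Coprime l := Nat.Coprime.of_dvd g1.1 l1.1 h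
    have : ((g : ℤ) ^ k * (l : ℤ) ^ k) ∣ a :=
      IsCoprime.mul_dvd (IsCoprime.pow (Nat.isCoprime_iff_coprime.2 hc)) g1.2 l1.2
    rw [← mul_pow] at this
    refine dvd_trans (pow_dvd_pow_of_dvd ?_ k) this
    exact_mod_cast hd
  · rintro ⟨h1, h2⟩
    obtain ⟨x, y, hx, hy, rfl⟩ := exists_dvd_and_dvd_of_dvd_mul h1
    push_cast at h2
    rw [mul_pow] at h2
    exact mul_dvd_mul ((hg _).2 ⟨hx, (dvd_mul_right _ _).trans h2⟩)
      ((hl _).2 ⟨hy, (dvd_mul_left _ _).trans h2⟩)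

lemma kgcd_period (k m : ℕ) (hm : 0 < m) (hk : 0 < k) (a b : ℤ) (h : (m : ℤ) ^ k ∣ a - b) :
    kgcd k a ((m : ℤ) ^ k) = kgcd k b ((m : ℤ) ^ k) := by
  obtain ⟨g, hg, eg⟩ := kgcd_spec k m hm b hk
  rw [eg]
  apply kgcd_eq k m g hm a hk
  intro d
  rw [hg]
  refine and_congr_right fun hd => ?_
  have : (d : ℤ) ^ k ∣ a - b :=
    (pow_dvd_pow_of_dvd (Int.natCast_dvd_natCast.2 hd) k).trans h
  exact (dvd_iff_dvd_of_dvd_sub this).symm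

lemma crt_sum (M N : ℕ) (hM : 0 < M) (hN : 0 < N) (h : M.Coprime N) (f g : ℤ → ℕ)
    (hf : ∀ a b : ℤ, (M : ℤ) ∣ a - b → f a = f b) (hg : ∀ a b : ℤ, (N : ℤ) ∣ a - b → g a = g b) :
    ∑ a ∈ Finset.range (M * N), f a * g a =
      (∑ a ∈ Finset.range M, f a) * ∑ a ∈ Finset.range N, g a := by
  rw [Finset.sum_mul_sum, ← Finset.sum_product']
  refine Finset.sum_bij (fun a _ => (a % M, a % N)) ?_ ?_ ?_ ?_
  · intro a _
    simp [Nat.mod_lt, hM, hN]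
  · intro a ha b hb hab
    simp only [Prod.mk.injEq] at hab
    have : a ≡ b [MOD M * N] := (Nat.modEq_and_modEq_iff_modEq_mul h).1 hab
    exact Nat.ModEq.eq_of_lt_of_lt this (Finset.mem_range.1 ha) (Finset.mem_range.1 hb)
  · rintro ⟨x, y⟩ hxy
    simp only [Finset.mem_product, Finset.mem_range] at hxy
    refine ⟨Nat.chineseRemainder h x y, Finset.mem_range.2
      (Nat.chineseRemainder_lt_mul h x y hM.ne' hN.ne'), ?_⟩
    have := (Nat.chineseRemainder h x y).2
    simp only [Prod.mk.injEq]
    exact ⟨Eq.trans this.1 (Nat.mod_eq_of_lt hxy.1), Eq.trans this.2 (Nat.mod_eq_of_lt hxy.2)⟩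
  · intro a _
    simp only
    congr 1
    · apply hf
      push_cast
      exact Int.dvd_self_sub_emod
    · apply hg
      push_cast
      exact Int.dvd_self_sub_emod

lemma sum_Icc_range (N : ℕ) (f : ℤ → ℕ) (h : f N = f 0) :
    ∑ a ∈ Finset.Icc 1 N, f (a : ℤ) = ∑ a ∈ Finset.range N, f (a : ℤ) := by
  have h1 := Finset.sum_range_succ (fun a : ℕ => f a) N
  have h2 := Finset.sum_range_succ' (fun a : ℕ => f a) N
  have h3 : ∑ a ∈ Finset.Icc 1 N, f (a : ℤ) = ∑ a ∈ Finset.range N, f ((a + 1 : ℕ) : ℤ) := by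
    rw [← Finset.sum_image (s := Finset.range N) (g := fun a => a + 1) (f := fun a : ℕ => f a)
      (by intro a _ b _ hab; simpa using hab)]
    congr 1
    ext x
    simp only [Finset.mem_Icc, Finset.mem_image, Finset.mem_range]
    constructor
    · intro hx; exact ⟨x - 1, by omega, by omega⟩
    · rintro ⟨y, hy, rfl⟩; omega
  rw [h3]
  simp only [Nat.cast_zero] at h2
  omega

lemma count_lemma (r t : ℕ) (hr : 0 < r) (s : ℤ) :
    ∑ a ∈ Finset.range (r * t), (if (r : ℤ) ∣ (a : ℤ) - s then 1 else 0) = t := by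
  -- reduce to one period
  have one : ∑ a ∈ Finset.range r, (if (r : ℤ) ∣ (a : ℤ) - s then 1 else 0) = 1 := by
    have hr' : (0 : ℤ) < r := by exact_mod_cast hr
    have e0 := Int.emod_nonneg s hr'.ne'
    have e1 := Int.emod_lt_of_pos s hr'
    rw [Finset.sum_eq_single (s % r).toNat]
    · rw [if_pos]
      rw [Int.toNat_of_nonneg e0]
      rw [dvd_sub_comm]
      exact Int.dvd_self_sub_emod
    · intro b hb hne
      rw [if_neg]
      intro hd
      apply hne
      have : (b : ℤ) % r = s % r := Int.emod_eq_emod_iff_emod_sub_eq_zero.2 (Int.emod_eq_zero_of_dvd hd)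
      have hb' : (b : ℤ) < r := by exact_mod_cast Finset.mem_range.1 hb
      rw [Int.emod_eq_of_lt (by positivity) hb'] at this
      omega
    · intro hn
      exfalso
      apply hn
      rw [Finset.mem_range]
      omega
  induction t with
  | zero => simp
  | succ t ih =>
    rw [mul_add, mul_one, Finset.sum_range_add, ih]
    congr 1
    refine Eq.trans ?_ one
    apply Finset.sum_congr rfl
    intro a _
    have : (r : ℤ) ∣ ((r * t + a : ℕ) : ℤ) - s ↔ (r : ℤ) ∣ (a : ℤ) - s := by
      have e : ((r * t + a : ℕ) : ℤ) - s = r * t + (a - s) := by push_cast; ring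
      rw [e]
      exact dvd_add_right (dvd_mul_right _ _)
    simp only [this]

lemma kgcd_pp_succ (k p v : ℕ) (hk : 0 < k) (hp : p.Prime) (b : ℤ) :
    kgcd k b (((p ^ (v + 1) : ℕ) : ℤ) ^ k) = kgcd k b (((p ^ v : ℕ) : ℤ) ^ k) +
      (if (((p ^ k) ^ (v + 1) : ℕ) : ℤ) ∣ b then 1 else 0) * ((p ^ k) ^ (v + 1) - (p ^ k) ^ v) := by
  have e : ∀ i, (((p ^ k) ^ i : ℕ) : ℤ) = ((p ^ i : ℕ) : ℤ) ^ k := by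
    intro i; push_cast; rw [← pow_mul, ← pow_mul, mul_comm]
  have full : ∀ i, (((p ^ k) ^ i : ℕ) : ℤ) ∣ b → kgcd k b (((p ^ i : ℕ) : ℤ) ^ k) = (p ^ k) ^ i := by
    intro i hi
    rw [e] at hi
    rw [kgcd_eq k (p ^ i) (p ^ i) (pow_pos hp.pos _) b hk, ← pow_mul, ← pow_mul, mul_comm]
    intro d
    exact ⟨fun h => ⟨h, (pow_dvd_pow_of_dvd (Int.natCast_dvd_natCast.2 h) k).trans hi⟩, fun h => h.1⟩
  split_ifs with h
  · rw [full _ h, full v]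
    · have : (p ^ k) ^ v ≤ (p ^ k) ^ (v + 1) :=
        Nat.pow_le_pow_right (pow_pos hp.pos _) (by omega)
      omega
    · refine dvd_trans ?_ h
      exact Int.natCast_dvd_natCast.2 (pow_dvd_pow _ (by omega))
  · obtain ⟨g, hg, eg⟩ := kgcd_spec k (p ^ v) (pow_pos hp.pos _) b hk
    rw [eg, zero_mul, add_zero]
    apply kgcd_eq k _ g (pow_pos hp.pos _) b hk
    intro d
    rw [hg]
    constructor
    · rintro ⟨h1, h2⟩
      exact ⟨h1.trans (pow_dvd_pow _ (by omega)), h2⟩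
    · rintro ⟨h1, h2⟩
      obtain ⟨i, hi, rfl⟩ := (Nat.dvd_prime_pow hp).1 h1
      refine ⟨pow_dvd_pow _ ?_, h2⟩
      by_contra hlt
      have : i = v + 1 := by omega
      subst this
      rw [e] at h
      exact h h2

lemma kgcd_one (k : ℕ) (hk : 0 < k) (b : ℤ) : kgcd k b (((1 : ℕ) : ℤ) ^ k) = 1 := by
  rw [kgcd_eq k 1 1 one_pos b hk, one_pow]
  intro d
  constructor
  · intro h
    refine ⟨h, ?_⟩
    rw [Nat.dvd_one] at h
    subst h
    simp
  · exact fun h => h.1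

lemma kgcd_pp (k p v : ℕ) (hk : 0 < k) (hp : p.Prime) (b : ℤ) :
    kgcd k b (((p ^ v : ℕ) : ℤ) ^ k) = 1 + ∑ j ∈ Finset.range v,
      (if (((p ^ k) ^ (j + 1) : ℕ) : ℤ) ∣ b then 1 else 0) * ((p ^ k) ^ (j + 1) - (p ^ k) ^ j) := by
  induction v with
  | zero => rw [pow_zero, kgcd_one k hk]; simp
  | succ v ih => rw [kgcd_pp_succ k p v hk hp b, Finset.sum_range_succ, ih, add_assoc]

lemma kgcd_pp_one (k p v : ℕ) (hk : 0 < k) (hv : 0 < v) (hp : p.Prime) (b : ℤ) :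
    kgcd k b (((p ^ v : ℕ) : ℤ) ^ k) = 1 ↔ ¬ ((p : ℤ) ^ k ∣ b) := by
  obtain ⟨g, hg, eg⟩ := kgcd_spec k (p ^ v) (pow_pos hp.pos _) b hk
  rw [eg, Nat.pow_eq_one]
  constructor
  · rintro h hd
    have : p ∣ g := (hg p).2 ⟨dvd_pow_self _ hv.ne', hd⟩
    have hg1 : g = 1 := by omega
    rw [hg1] at this
    exact hp.one_lt.ne' (Nat.dvd_one.1 this)
  · intro h
    left
    by_contra hne
    have h1 := (hg g).1 dvd_rfl
    obtain ⟨i, hi, rfl⟩ := (Nat.dvd_prime_pow hp).1 h1.1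
    have hi0 : i ≠ 0 := by rintro rfl; simp at hne
    exact h ((hg p).1 (dvd_pow_self _ hi0)).2

/-- weighted sum over a full residue system -/
noncomputable def FS (s : ℤ) (k m : ℕ) : ℕ :=
  ∑ a ∈ Finset.range (m ^ k), (if kgcd k (a : ℤ) ((m : ℤ) ^ k) = 1 then 1 else 0) *
    kgcd k ((a : ℤ) - s) ((m : ℤ) ^ k)

noncomputable def FT (k m : ℕ) : ℕ :=
  ∑ a ∈ Finset.range (m ^ k), (if kgcd k (a : ℤ) ((m : ℤ) ^ k) = 1 then 1 else 0)

lemma ind_mul (k m n : ℕ) (hm : 0 < m) (hn : 0 < n) (hk : 0 < k) (h : m.Coprime n) (a : ℤ) :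
    (if kgcd k a (((m * n : ℕ) : ℤ) ^ k) = 1 then 1 else 0) =
    (if kgcd k a ((m : ℤ) ^ k) = 1 then 1 else 0) * (if kgcd k a ((n : ℤ) ^ k) = 1 then 1 else 0) := by
  simp only [kgcd_mul k m n hm hn hk h, mul_eq_one]
  split_ifs <;> simp_all

lemma FT_mul (k m n : ℕ) (hm : 0 < m) (hn : 0 < n) (hk : 0 < k) (h : m.Coprime n) :
    FT k (m * n) = FT k m * FT k n := by
  unfold FT
  rw [mul_pow, ← crt_sum (m ^ k) (n ^ k) (pow_pos hm k) (pow_pos hn k) (Nat.Coprime.pow k k h)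
    (fun a => if kgcd k a ((m : ℤ) ^ k) = 1 then 1 else 0)
    (fun a => if kgcd k a ((n : ℤ) ^ k) = 1 then 1 else 0)]
  · exact Finset.sum_congr rfl fun a _ => ind_mul k m n hm hn hk h a
  · intro a b hab
    simp only [kgcd_period k m hm hk a b (by exact_mod_cast hab)]
  · intro a b hab
    simp only [kgcd_period k n hn hk a b (by exact_mod_cast hab)]

lemma FS_mul (s : ℤ) (k m n : ℕ) (hm : 0 < m) (hn : 0 < n) (hk : 0 < k) (h : m.Coprime n) :
    FS s k (m * n) = FS s k m * FS s k n := by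
  unfold FS
  rw [mul_pow, ← crt_sum (m ^ k) (n ^ k) (pow_pos hm k) (pow_pos hn k) (Nat.Coprime.pow k k h)
    (fun a => (if kgcd k a ((m : ℤ) ^ k) = 1 then 1 else 0) * kgcd k (a - s) ((m : ℤ) ^ k))
    (fun a => (if kgcd k a ((n : ℤ) ^ k) = 1 then 1 else 0) * kgcd k (a - s) ((n : ℤ) ^ k))]
  · refine Finset.sum_congr rfl fun a _ => ?_
    rw [ind_mul k m n hm hn hk h a, kgcd_mul k m n hm hn hk h]
    ring
  · intro a b hab
    simp only [kgcd_period k m hm hk a b (by exact_mod_cast hab),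
      kgcd_period k m hm hk (a - s) (b - s) (by simpa using hab)]
  · intro a b hab
    simp only [kgcd_period k n hn hk a b (by exact_mod_cast hab),
      kgcd_period k n hn hk (a - s) (b - s) (by simpa using hab)]

lemma dsk_mul (s : ℤ) (k m n : ℕ) (h : m.Coprime n) :
    dsk s k (m * n) = dsk s k m * dsk s k n := by
  unfold dsk
  rw [Nat.Coprime.primeFactors_mul h, Finset.prod_union h.disjoint_primeFactors]
  congr 1
  · refine Finset.prod_congr rfl fun p hp => ?_
    rw [Nat.factorization_eq_of_coprime_left h (by simpa using hp)]
  · refine Finset.prod_congr rfl fun p hp => ?_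
    rw [Nat.factorization_eq_of_coprime_right h (by simpa using hp)]

lemma FT_pp (k p v : ℕ) (hk : 0 < k) (hv : 0 < v) (hp : p.Prime) :
    FT k (p ^ v) + (p ^ k) ^ (v - 1) = (p ^ k) ^ v := by
  have hc := count_lemma (p ^ k) ((p ^ k) ^ (v - 1)) (pow_pos hp.pos _) 0
  have hq : (p ^ v) ^ k = p ^ k * (p ^ k) ^ (v - 1) := by
    rw [← pow_succ', Nat.sub_add_cancel hv, ← pow_mul, ← pow_mul, mul_comm]
  have hq2 : p ^ k * (p ^ k) ^ (v - 1) = (p ^ k) ^ v := by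
    rw [← pow_succ', Nat.sub_add_cancel hv]
  unfold FT
  rw [hq]
  nth_rewrite 2 [← hc]
  rw [← Finset.sum_add_distrib]
  rw [Finset.sum_congr rfl (g := fun _ => 1)]
  · simp [hq2]
  · intro a _
    have e := kgcd_pp_one k p v hk hv hp (a : ℤ)
    simp only [sub_zero, Nat.cast_pow] at e ⊢
    simp only [e]
    split_ifs <;> simp_all

lemma FS_pp (s : ℤ) (k p v : ℕ) (hk : 0 < k) (hv : 0 < v) (hp : p.Prime) :
    FS s k (p ^ v) = dsk s k (p ^ v) * FT k (p ^ v) := by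
  have hd : dsk s k (p ^ v) = if (p : ℤ) ^ k ∣ s then 1 else v + 1 := by
    unfold dsk
    rw [Nat.primeFactors_prime_pow hv.ne' hp]
    simp [hp.factorization_self]
  rw [hd]
  split_ifs with hs
  · rw [one_mul]
    unfold FS FT
    refine Finset.sum_congr rfl fun a _ => ?_
    by_cases ha : kgcd k (a : ℤ) (((p ^ v : ℕ) : ℤ) ^ k) = 1
    · rw [if_pos ha, one_mul]
      rw [kgcd_pp_one k p v hk hv hp] at ha ⊢
      rwa [dvd_sub_left hs]
    · rw [if_neg ha, zero_mul]
  · have hF := FT_pp k p v hk hv hp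
    have : FS s k (p ^ v) = FT k (p ^ v) + ∑ j ∈ Finset.range v,
        (p ^ k) ^ (v - 1 - j) * ((p ^ k) ^ (j + 1) - (p ^ k) ^ j) := by
      unfold FS FT
      have e1 : ∀ a : ℕ, (if kgcd k (a : ℤ) (((p ^ v : ℕ) : ℤ) ^ k) = 1 then 1 else 0) *
          kgcd k ((a : ℤ) - s) (((p ^ v : ℕ) : ℤ) ^ k) =
          (if kgcd k (a : ℤ) (((p ^ v : ℕ) : ℤ) ^ k) = 1 then 1 else 0) +
          ∑ j ∈ Finset.range v, (if (((p ^ k) ^ (j + 1) : ℕ) : ℤ) ∣ (a : ℤ) - s then 1 else 0) *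
            ((p ^ k) ^ (j + 1) - (p ^ k) ^ j) := by
        intro a
        rw [kgcd_pp k p v hk hp ((a : ℤ) - s)]
        by_cases ha : kgcd k (a : ℤ) (((p ^ v : ℕ) : ℤ) ^ k) = 1
        · rw [if_pos ha, one_mul]
        · rw [if_neg ha, zero_mul, zero_add]
          symm
          apply Finset.sum_eq_zero
          intro j _
          rw [if_neg, zero_mul]
          intro hj
          rw [kgcd_pp_one k p v hk hv hp, not_not] at ha
          apply hs
          have h1 : (p : ℤ) ^ k ∣ (a : ℤ) - s := by
            refine dvd_trans ?_ hj
            push_cast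
            exact dvd_pow_self _ (by omega)
          exact (dvd_sub_right ha).1 h1
      rw [Finset.sum_congr rfl fun a _ => e1 a, Finset.sum_add_distrib, Finset.sum_comm]
      congr 1
      refine Finset.sum_congr rfl fun j hj => ?_
      rw [← Finset.sum_mul]
      congr 1
      have hj' := Finset.mem_range.1 hj
      have hq : (p ^ v) ^ k = (p ^ k) ^ (j + 1) * (p ^ k) ^ (v - 1 - j) := by
        rw [← pow_add, ← pow_mul, ← pow_mul, mul_comm]
        congr 2
        omega
      rw [hq]
      exact count_lemma _ _ (pow_pos (pow_pos hp.pos _) _) s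
    rw [this, Finset.sum_congr rfl (g := fun _ => FT k (p ^ v))]
    · simp; ring
    · intro j hj
      have hj' := Finset.mem_range.1 hj
      rw [Nat.mul_sub, ← pow_add, ← pow_add]
      have a1 : v - 1 - j + (j + 1) = v := by omega
      have a2 : v - 1 - j + j = v - 1 := by omega
      rw [a1, a2]
      omega

lemma FS_eq (s : ℤ) (k m : ℕ) (hk : 0 < k) (hm : 0 < m) : FS s k m = dsk s k m * FT k m := by
  induction m using Nat.recOnPosPrimePosCoprime with
  | prime_pow p n hp hn => exact FS_pp s k p n hk hn hp
  | zero => omega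
  | one =>
    have := kgcd_one k hk
    simp only [Nat.cast_one, one_pow] at this
    simp [FS, FT, dsk, this]
  | coprime a b ha hb hab iha ihb =>
    rw [FS_mul s k a b (by omega) (by omega) hk hab, FT_mul k a b (by omega) (by omega) hk hab,
      dsk_mul s k a b hab, iha (by omega), ihb (by omega)]
    ring

/-- For every integer `s` and all positive integers `k` and `m`, the sum of `(a-s, m^k)_k`
over `1 ≤ a ≤ m^k` with `(a, m^k)_k = 1` equals `d_s^(k)(m)·φ^(k)(m)`. -/
theorem menon_rao_general (s : ℤ) (k m : ℕ) (hk : 0 < k) (hm : 0 < m) :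
    ∑ a ∈ (Finset.Icc 1 (m ^ k)).filter (fun a : ℕ => kgcd k (a : ℤ) ((m : ℤ) ^ k) = 1),
      kgcd k ((a : ℤ) - s) ((m : ℤ) ^ k) = dsk s k m * cohenTotient k m := by
  have per : ∀ t : ℤ, kgcd k (((m ^ k : ℕ) : ℤ) - t) ((m : ℤ) ^ k) =
      kgcd k (0 - t) ((m : ℤ) ^ k) := fun t => kgcd_period k m hm hk _ _ (by simp)
  have per0 := per 0
  simp only [sub_zero] at per0
  have h1 : ∑ a ∈ (Finset.Icc 1 (m ^ k)).filter
      (fun a : ℕ => kgcd k (a : ℤ) ((m : ℤ) ^ k) = 1),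
      kgcd k ((a : ℤ) - s) ((m : ℤ) ^ k) = FS s k m := by
    unfold FS
    rw [← sum_Icc_range (m ^ k) (fun a => (if kgcd k a ((m : ℤ) ^ k) = 1 then 1 else 0) *
      kgcd k (a - s) ((m : ℤ) ^ k)) (by simp only [per, per0]), Finset.sum_filter]
    refine Finset.sum_congr rfl fun a _ => ?_
    split_ifs <;> simp
  have h2 : cohenTotient k m = FT k m := by
    unfold FT cohenTotient
    rw [← sum_Icc_range (m ^ k) (fun a => (if kgcd k a ((m : ℤ) ^ k) = 1 then 1 else 0))
      (by simp only [per0]), Finset.card_filter]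
  rw [h1, h2, FS_eq s k m hk hm]
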